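/- arXiv:2102.11409 — 2 statements merged into one kernel-verified Lean document; each statement's English description precedes it below -/
import Mathlib

section
/- Let N ≥ 2 and d ≥ 1. For feature locations Z : Fin N → ℝ^d define the RBF kernel Gram matrix K(Z) with entries K(Z)_{ab} = exp(−‖Z a − Z b‖²), where ‖·‖ is the Euclidean norm. Then the complexity penalty is unbounded below over collapsed features and shrinking noise: for every M ∈ ℝ there exist Z : Fin N → ℝ^d, σ_f > 0, and σ_n > 0 such that the matrix σ_f²·K(Z) + σ_n²·I is positive definite and log det(σ_f²·K(Z) + σ_n²·I) < M. -/
/-- For the RBF kernel Gram matrix `K(Z)_{ab} = exp(-‖Z a - Z b‖²)`,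
the complexity penalty `log det (σ_f² K(Z) + σ_n² I)` is unbounded below over
feature locations `Z` and scales `σ_f, σ_n > 0`. -/
theorem stmt_5 (N d : ℕ) (hN : 2 ≤ N) (hd : 1 ≤ d) :
    ∀ M : ℝ, ∃ (Z : Fin N → EuclideanSpace ℝ (Fin d)) (σf σn : ℝ),
      0 < σf ∧ 0 < σn ∧
      (σf ^ 2 • (Matrix.of fun a b : Fin N => Real.exp (-‖Z a - Z b‖ ^ 2))
          + σn ^ 2 • (1 : Matrix (Fin N) (Fin N) ℝ)).PosDef ∧
      Real.log (σf ^ 2 • (Matrix.of fun a b : Fin N => Real.exp (-‖Z a - Z b‖ ^ 2))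
          + σn ^ 2 • (1 : Matrix (Fin N) (Fin N) ℝ)).det < M := by
  intro M
  haveI : Nontrivial (Fin N) := Fin.nontrivial_iff_two_le.mpr hN
  have hJ : (Matrix.of fun a b : Fin N => Real.exp
      (-‖(0 : Fin N → EuclideanSpace ℝ (Fin d)) a
        - (0 : Fin N → EuclideanSpace ℝ (Fin d)) b‖ ^ 2))
      = Matrix.vecMulVec (fun _ => (1 : ℝ)) (star fun _ => (1 : ℝ)) := by
    ext a b
    simp [Matrix.vecMulVec_apply]
  have hc : Continuous fun s : ℝ =>
      ((1 : ℝ) ^ 2 • Matrix.vecMulVec (fun _ : Fin N => (1 : ℝ)) (star fun _ => (1 : ℝ))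
        + s ^ 2 • (1 : Matrix (Fin N) (Fin N) ℝ)).det := by
    apply Continuous.matrix_det
    fun_prop
  have h0 := hc.tendsto 0
  simp only [one_pow, one_smul, ne_eq, OfNat.ofNat_ne_zero, not_false_eq_true, zero_pow,
    zero_smul, add_zero, Matrix.det_vecMulVec] at h0
  have hev := h0.eventually (gt_mem_nhds (Real.exp_pos M))
  have hev' := (hev.filter_mono (nhdsWithin_le_nhds (s := Set.Ioi 0))).and self_mem_nhdsWithin
  obtain ⟨s, hs, hs0⟩ := hev'.exists
  have hs0 : 0 < s := hs0
  have hpd : ((1 : ℝ) ^ 2 • Matrix.vecMulVec (fun _ : Fin N => (1 : ℝ)) (star fun _ => (1 : ℝ))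
        + s ^ 2 • (1 : Matrix (Fin N) (Fin N) ℝ)).PosDef := by
    rw [one_pow, one_smul]
    exact Matrix.PosDef.posSemidef_add (Matrix.posSemidef_vecMulVec_self_star _)
      (Matrix.PosDef.one.smul (by positivity))
  refine ⟨0, 1, s, one_pos, hs0, ?_, ?_⟩
  · rw [hJ]; exact hpd
  · rw [hJ, Real.log_lt_iff_lt_exp hpd.det_pos, one_pow, one_smul]
    exact hs
end

section
/- Let N ≥ 2, d ≥ 1, and let y ∈ ℝ^N be a nonzero target vector such that y i = y j for some pair of distinct indices i ≠ j. For feature locations Z : Fin N → ℝ^d define the RBF kernel Gram matrix K(Z) with entries K(Z)_{ab} = exp(−‖Z a − Z b‖²), and for σ_f, σ_n > 0 define the covariance Σ(Z, σ_f, σ_n) = σ_f²·K(Z) + σ_n²·I and the Gaussian log marginal likelihood ℓ(Z, σ_f, σ_n) = −(1/2)·log det Σ − (1/2)·yᵀΣ⁻¹y − (N/2)·log(2π). Then ℓ is unbounded above: for every M ∈ ℝ there exist Z : Fin N → ℝ^d, σ_f > 0, and σ_n > 0 such that Σ(Z, σ_f, σ_n) is positive definite and ℓ(Z, σ_f, σ_n)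 > M. In particular, the unboundedness can be achieved by choosing Z with Z i = Z j, i.e., by mapping the two data points with equal targets to the same feature representation. -/
open Matrix Filter Topology

lemma aux_pd (N : ℕ) (E : Matrix (Fin N) (Fin N) ℝ) (hE : E.IsHermitian) (e s : ℝ)
    (he : ∀ a b, |E a b| ≤ e) (hs : N * e < s) : (E + s • (1 : Matrix (Fin N) (Fin N) ℝ)).PosDef := by
  refine Matrix.PosDef.of_dotProduct_mulVec_pos ?_ ?_
  · exact hE.add (by simp [Matrix.IsHermitian])
  · intro x hx
    have hx2 : 0 < ∑ a, x a ^ 2 := by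
      obtain ⟨a, ha⟩ := Function.ne_iff.mp hx
      exact Finset.sum_pos' (fun _ _ => sq_nonneg _) ⟨a, Finset.mem_univ _, by
        have : x a ≠ 0 := ha
        positivity⟩
    have h1 : star x ⬝ᵥ ((E + s • (1 : Matrix (Fin N) (Fin N) ℝ)) *ᵥ x)
        = (∑ a, ∑ b, x a * E a b * x b) + s * ∑ a, x a ^ 2 := by
      simp only [Matrix.add_mulVec, Matrix.smul_mulVec, Matrix.one_mulVec, dotProduct_add, dotProduct_smul]
      simp [dotProduct, mulVec, Finset.mul_sum, pow_two, mul_assoc]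
    have h2 : ∀ a b, -(e * ((x a ^2 + x b ^2)/2)) ≤ x a * E a b * x b := by
      intro a b
      have h := abs_le.mp (he a b)
      have h3 : |x a * E a b * x b| ≤ e * ((x a ^2 + x b ^2)/2) := by
        have : |x a * E a b * x b| = |E a b| * (|x a| * |x b|) := by rw [abs_mul, abs_mul]; ring
        rw [this]
        have := two_mul_le_add_sq |x a| |x b|
        simp only [sq_abs] at this
        exact mul_le_mul (he a b) (by linarith) (by positivity) ((abs_nonneg _).trans (he a b))
      exact (abs_le.mp h3).1
    have h4 : -(N * e * ∑ a, x a ^ 2) ≤ ∑ a, ∑ b, x a * E a b * x b := by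
      refine le_trans (le_of_eq ?_) (Finset.sum_le_sum fun a _ => Finset.sum_le_sum fun b _ => h2 a b)
      simp only [Finset.sum_neg_distrib, ← Finset.mul_sum, ← Finset.sum_div, Finset.sum_add_distrib, Finset.sum_const, Finset.card_univ, Fintype.card_fin, nsmul_eq_mul]
      ring
    rw [h1]
    nlinarith

lemma aux_psd (N : ℕ) (f : Fin N → Fin N) :
    (Matrix.of fun a b : Fin N => if f a = f b then (1:ℝ) else 0).PosSemidef := by
  convert Matrix.posSemidef_conjTranspose_mul_self (Matrix.of fun c a : Fin N => if f a = c then (1:ℝ) else 0) using 1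
  ext a b
  simp [Matrix.mul_apply, eq_comm]

lemma aux_cont (N : ℕ) (y : Fin N → ℝ) (C : ℝ) (S : ℕ → Matrix (Fin N) (Fin N) ℝ) (S0 : Matrix (Fin N) (Fin N) ℝ)
    (h : Tendsto S atTop (𝓝 S0)) (h0 : S0.det ≠ 0) :
    Tendsto (fun n => -(1 / 2 : ℝ) * Real.log (S n).det - (1 / 2 : ℝ) * (y ⬝ᵥ (S n)⁻¹.mulVec y) - C) atTop
     (𝓝 (-(1 / 2 : ℝ) * Real.log S0.det - (1 / 2 : ℝ) * (y ⬝ᵥ S0⁻¹.mulVec y) - C)) := by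
  have hd : Tendsto (fun n => (S n).det) atTop (𝓝 S0.det) :=
    ((continuous_id.matrix_det).tendsto S0).comp h
  have ha : Tendsto (fun n => (S n).adjugate) atTop (𝓝 S0.adjugate) :=
    ((continuous_id.matrix_adjugate).tendsto S0).comp h
  have hi : Tendsto (fun n => (S n)⁻¹) atTop (𝓝 S0⁻¹) := by
    simp only [Matrix.inv_def, Ring.inverse_eq_inv']
    exact (hd.inv₀ h0).smul ha
  have hq : Continuous fun A : Matrix (Fin N) (Fin N) ℝ => y ⬝ᵥ A.mulVec y := by fun_prop
  exact (((hd.log h0).const_mul _).sub (((hq.tendsto _).comp hi).const_mul _)).sub_const _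

lemma aux_quad (N : ℕ) (y : Fin N → ℝ) (i j : Fin N) (hij : i ≠ j) (hyij : y i = y j) (s : ℝ) (hs : 0 < s)
   (f : Fin N → Fin N) (hf : f = fun a => if a = j then i else a)
   (S : Matrix (Fin N) (Fin N) ℝ) (hS : S = (Matrix.of fun a b : Fin N => if f a = f b then (1:ℝ) else 0) + s • 1)
   (h0 : S.det ≠ 0) : y ⬝ᵥ S⁻¹.mulVec y ≤ ∑ a, y a ^ 2 := by
  set c : Fin N → ℝ := fun a => if f a = i then 2 else 1 with hc
  set w : Fin N → ℝ := fun a => y a / (c a + s) with hw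
  have hc1 : ∀ a, 1 ≤ c a := by intro a; simp only [hc]; split_ifs <;> norm_num
  have hfi : f i = i := by simp [hf, hij]
  have hfj : f j = i := by simp [hf]
  have key : S.mulVec w = y := by
    ext a
    have e1 : S.mulVec w a = (∑ b, if f a = f b then w b else 0) + s * w a := by
      rw [hS, Matrix.add_mulVec, Matrix.smul_mulVec, Matrix.one_mulVec]
      simp [mulVec, dotProduct]
    have e2 : (∑ b, if f a = f b then w b else 0) = c a * w a := by
      by_cases ha : f a = i
      · have haij : a = i ∨ a = j := by
          by_cases h : a = j
          · exact Or.inr h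
          · left; simpa [hf, h] using ha
        have hwij : w i = w j := by simp only [hw, hc, hfi, hfj, hyij]
        have : ∀ b, (if f a = f b then w b else 0) = (if b = i then w b else 0) + (if b = j then w b else 0) := by
          intro b
          rw [ha]
          by_cases h1 : b = i
          · subst h1; simp [hfi, hij]
          · by_cases h2 : b = j
            · subst h2; simp [hfj, h1]
            · simp [hf, h1, h2, Ne.symm h1]
        simp only [this, Finset.sum_add_distrib, Finset.sum_ite_eq', Finset.mem_univ, if_true]
        rcases haij with rfl | rfl <;> simp only [hc, ha, if_true] <;> linarith
      · have haj : a ≠ j := by rintro rfl; exact ha hfj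
        have hfa : f a = a := by simp [hf, haj]
        have : ∀ b, (if f a = f b then w b else 0) = (if b = a then w b else 0) := by
          intro b
          rw [hfa]
          rw [hfa] at ha
          by_cases h2 : b = j
          · subst h2; simp [hfj, ha, haj.symm]
          · have hfb : f b = b := by simp [hf, h2]
            rw [hfb]; simp only [eq_comm]
        simp [this, hc, ha]
    have : c a + s ≠ 0 := by linarith [hc1 a]
    rw [e1, e2, ← add_mul]
    simp only [hw]; field_simp
  have hinv : S⁻¹.mulVec y = w := by
    rw [← key, Matrix.mulVec_mulVec, Matrix.nonsing_inv_mul _ (isUnit_iff_ne_zero.mpr h0), Matrix.one_mulVec]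
  rw [hinv]
  refine Finset.sum_le_sum fun a _ => ?_
  have : 1 ≤ c a + s := by linarith [hc1 a]
  simp only [hw]
  rw [← mul_div_assoc, ← pow_two]
  exact div_le_self (sq_nonneg _) this

theorem stmt_6 (N d : ℕ) (hN : 2 ≤ N) (hd : 1 ≤ d)
    (y : Fin N → ℝ) (hy : y ≠ 0) (i j : Fin N) (hij : i ≠ j) (hyij : y i = y j) :
    ∀ M : ℝ, ∃ (Z : Fin N → EuclideanSpace ℝ (Fin d)) (σf σn : ℝ),
      0 < σf ∧ 0 < σn ∧ Z i = Z j ∧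
      (σf ^ 2 • (Matrix.of fun a b : Fin N => Real.exp (-‖Z a - Z b‖ ^ 2))
          + σn ^ 2 • (1 : Matrix (Fin N) (Fin N) ℝ)).PosDef ∧
      M <
        -(1 / 2 : ℝ) *
            Real.log (σf ^ 2 • (Matrix.of fun a b : Fin N => Real.exp (-‖Z a - Z b‖ ^ 2))
                + σn ^ 2 • (1 : Matrix (Fin N) (Fin N) ℝ)).det
          - (1 / 2 : ℝ) *
            (y ⬝ᵥ (σf ^ 2 • (Matrix.of fun a b : Fin N => Real.exp (-‖Z a - Z b‖ ^ 2))
                + σn ^ 2 • (1 : Matrix (Fin N) (Fin N) ℝ))⁻¹.mulVec y)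
          - ((N : ℝ) / 2) * Real.log (2 * Real.pi) := by
  intro M
  obtain ⟨f, hf⟩ : ∃ f : Fin N → Fin N, f = fun a => if a = j then i else a := ⟨_, rfl⟩
  have hfi : f i = i := by simp [hf, hij]
  have hfj : f j = i := by simp [hf]
  obtain ⟨P, hP⟩ : ∃ P : Matrix (Fin N) (Fin N) ℝ, P = Matrix.of fun a b : Fin N => if f a = f b then (1:ℝ) else 0 := ⟨_, rfl⟩
  have hPpsd : P.PosSemidef := hP ▸ aux_psd N f
  have hpd0 : ∀ σ : ℝ, 0 < σ → (P + σ ^ 2 • (1 : Matrix (Fin N) (Fin N) ℝ)).PosDef := by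
    intro σ hσ
    have := aux_pd N 0 (by simp) 0 (σ^2) (by simp) (by simp; positivity)
    rw [zero_add] at this
    exact this.posSemidef_add hPpsd
  have hP0 : P.det = 0 := by
    refine Matrix.det_zero_of_row_eq hij ?_
    ext b; simp [hP, hfi, hfj]
  have hdet : Tendsto (fun σ : ℝ => (P + σ ^ 2 • (1 : Matrix (Fin N) (Fin N) ℝ)).det) (𝓝[>] 0) (𝓝[>] 0) := by
    refine tendsto_nhdsWithin_iff.mpr ⟨?_, ?_⟩
    · have : Continuous (fun σ : ℝ => (P + σ ^ 2 • (1 : Matrix (Fin N) (Fin N) ℝ)).det) := by fun_prop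
      have h := this.tendsto 0
      simp only [ne_eq, OfNat.ofNat_ne_zero, not_false_eq_true, zero_pow, zero_smul, add_zero, hP0] at h
      exact h.mono_left nhdsWithin_le_nhds
    · filter_upwards [self_mem_nhdsWithin] with σ hσ
      exact (hpd0 σ hσ).det_pos
  have hlog := Real.tendsto_log_nhdsGT_zero.comp hdet
  obtain ⟨σ, hσl, hσ⟩ := ((hlog.eventually (eventually_lt_atBot
    (-2 * (M + (1/2) * ∑ a, y a ^ 2 + ((N : ℝ) / 2) * Real.log (2 * Real.pi))))).and self_mem_nhdsWithin).exists
  replace hσ : 0 < σ := hσ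
  simp only [Function.comp] at hσl
  have hne := (hpd0 σ hσ).det_pos.ne'
  have hquad := aux_quad N y i j hij hyij (σ^2) (by positivity) f hf _ (by rw [hP]) hne
  let Z : ℕ → Fin N → EuclideanSpace ℝ (Fin d) := fun n a => EuclideanSpace.single ⟨0, hd⟩ ((n : ℝ) * (f a : ℕ))
  have hZ : ∀ n a b, ‖Z n a - Z n b‖ ^ 2 = (n:ℝ)^2 * (((f a : ℕ):ℝ) - (f b : ℕ))^2 := by
    intro n a b
    simp only [Z]
    rw [← dist_eq_norm, EuclideanSpace.dist_single_same, Real.dist_eq, sq_abs]; ring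
  let K : ℕ → Matrix (Fin N) (Fin N) ℝ := fun n => Matrix.of fun a b : Fin N => Real.exp (-‖Z n a - Z n b‖ ^ 2)
  have hKe : ∀ a b, Tendsto (fun n => K n a b) atTop (𝓝 (P a b)) := by
    intro a b
    simp only [K, hP, Matrix.of_apply, hZ]
    split_ifs with h
    · simp [h]
    · have hpos : 0 < (((f a : ℕ):ℝ) - (f b : ℕ))^2 := by
        have : ((f a : ℕ):ℝ) - (f b : ℕ) ≠ 0 := by
          rw [sub_ne_zero]; exact_mod_cast fun h' => h (Fin.ext h')
        positivity
      refine Real.tendsto_exp_neg_atTop_nhds_zero.comp ?_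
      exact ((tendsto_pow_atTop two_ne_zero).comp tendsto_natCast_atTop_atTop).atTop_mul_const hpos
  have hK : Tendsto K atTop (𝓝 P) := tendsto_pi_nhds.mpr fun a => tendsto_pi_nhds.mpr fun b => hKe a b
  have hlim := aux_cont N y (((N : ℝ) / 2) * Real.log (2 * Real.pi)) _ _ (hK.add_const (σ^2 • (1 : Matrix (Fin N) (Fin N) ℝ))) hne
  have hev1 := hlim.eventually (lt_mem_nhds (a := M) (by linarith))
  have hN0 : (0:ℝ) < N := by exact_mod_cast (by omega : 0 < N)
  have hev2 : ∀ᶠ n in atTop, ∀ a b, |(K n - P) a b| ≤ σ^2 / (2 * N) := by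
    refine eventually_all.mpr fun a => eventually_all.mpr fun b => ?_
    have := (Metric.tendsto_nhds.mp (hKe a b)) (σ^2 / (2*N)) (by positivity)
    filter_upwards [this] with n hn
    exact (Real.dist_eq _ _ ▸ hn).le
  obtain ⟨n, h1, h2⟩ := (hev1.and hev2).exists
  have hKh : (K n).IsHermitian := by
    ext a b
    simp [K, norm_sub_rev (Z n b) (Z n a)]
  have hpd : (K n + σ^2 • (1 : Matrix (Fin N) (Fin N) ℝ)).PosDef := by
    have h := aux_pd N (K n - P) (hKh.sub hPpsd.isHermitian) _ (σ^2) h2 (by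
      have : (N:ℝ) * (σ^2 / (2 * N)) = σ^2/2 := by field_simp
      rw [this]; linarith [pow_pos hσ 2])
    have h' := h.add_posSemidef hPpsd
    convert h' using 1
    abel
  refine ⟨Z n, 1, σ, one_pos, hσ, by simp [Z, hfi, hfj], ?_, ?_⟩
  · rw [one_pow, one_smul]; exact hpd
  · rw [one_pow, one_smul]; exact h1
end
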